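/- Let V be a real inner product space and let R ⊆ V be a root system all of whose elements have square length 1 or 2. Let n ≥ 3 and β, α₁, …, αₙ ∈ V be such that: (i) the 4n vectors ε·αᵢ + ε′·β (1 ≤ i ≤ n, ε, ε′ ∈ {1, −1}) are pairwise distinct and all lie in R; denote by W the set of these vectors and set S := R \ W; (ii) S is closed; (iii) ⟨β, αᵢ⟩ ≥ 0 for all i. Then it is impossible that simultaneously β = α₁ + σ₂α₂ + σ₃α₃ for some signs σ₂, σ₃ ∈ {1, −1}, ‖β‖² = 1/4, ⟨β, α₁⟩ = 1/4, and ⟨β, α₂⟩ = ⟨β, α₃⟩ = 0. -/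

import Mathlib

open scoped RealInnerProductSpace

/-- A root system in a real inner product space `V`: a finite set `R ⊆ V` with
`0 ∉ R` (R1), the only multiples of a root in `R` being `±` that root (R2),
integrality of `2⟨α,β⟩/⟨α,α⟩` (R3), and stability under reflections (R4). -/
def IsRootSystem {V : Type*} [NormedAddCommGroup V] [InnerProductSpace ℝ V]
    (R : Set V) : Prop :=
  R.Finite ∧ (0 : V) ∉ R ∧
  (∀ a ∈ R, ∀ t : ℝ, t • a ∈ R → t • a = a ∨ t • a = -a) ∧
  (∀ a ∈ R, ∀ b ∈ R, ∃ k : ℤ, 2 * ⟪a, b⟫ / ⟪a, a⟫ = (k : ℝ)) ∧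
  (∀ a ∈ R, ∀ b ∈ R, b - (2 * ⟪a, b⟫ / ⟪a, a⟫) • a ∈ R)

/-- `S` is a closed subset of the root system `R`: whenever `x, y ∈ S` and
`x + y ∈ R`, also `x + y ∈ S`. -/
def IsClosedIn {V : Type*} [NormedAddCommGroup V] [InnerProductSpace ℝ V]
    (R S : Set V) : Prop :=
  ∀ x ∈ S, ∀ y ∈ S, x + y ∈ R → x + y ∈ S

/-- In a root system, reflecting shows that two roots with `⟪a, b⟫ = ⟪a, a⟫ / 2` have a root
difference. -/
lemma IsRootSystem.sub_mem {V : Type*} [NormedAddCommGroup V] [InnerProductSpace ℝ V]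
    {R : Set V} (hR : IsRootSystem R) {a b : V} (ha : a ∈ R) (hb : b ∈ R)
    (h : 2 * ⟪a, b⟫ / ⟪a, a⟫ = 1) : b - a ∈ R := by
  have := hR.2.2.2.2 a ha b hb
  rwa [h, one_smul] at this

theorem statement8 {V : Type*} [NormedAddCommGroup V] [InnerProductSpace ℝ V]
    (R : Set V) (hR : IsRootSystem R)
    (hlen : ∀ r ∈ R, ⟪r, r⟫ = 1 ∨ ⟪r, r⟫ = 2)
    (n : ℕ) (hn : 3 ≤ n) (β : V) (α : ℕ → V) (W : Set V)
    (hW : W = {v | ∃ i ∈ Finset.Icc 1 n, ∃ ε₁ ε₂ : ℝ,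
      (ε₁ = 1 ∨ ε₁ = -1) ∧ (ε₂ = 1 ∨ ε₂ = -1) ∧ v = ε₁ • α i + ε₂ • β})
    (hWR : W ⊆ R)
    (hdist : ∀ i ∈ Finset.Icc 1 n, ∀ j ∈ Finset.Icc 1 n, ∀ ε₁ ε₂ η₁ η₂ : ℝ,
      (ε₁ = 1 ∨ ε₁ = -1) → (ε₂ = 1 ∨ ε₂ = -1) → (η₁ = 1 ∨ η₁ = -1) → (η₂ = 1 ∨ η₂ = -1) →
      ε₁ • α i + ε₂ • β = η₁ • α j + η₂ • β → i = j ∧ ε₁ = η₁ ∧ ε₂ = η₂)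
    (hclosed : IsClosedIn R (R \ W))
    (hpos : ∀ i ∈ Finset.Icc 1 n, 0 ≤ ⟪β, α i⟫) :
    ¬ ((∃ σ₂ σ₃ : ℝ, (σ₂ = 1 ∨ σ₂ = -1) ∧ (σ₃ = 1 ∨ σ₃ = -1) ∧
        β = α 1 + σ₂ • α 2 + σ₃ • α 3) ∧
      ‖β‖ ^ 2 = 1 / 4 ∧ ⟪β, α 1⟫ = 1 / 4 ∧ ⟪β, α 2⟫ = 0 ∧ ⟪β, α 3⟫ = 0) := by
  rintro ⟨⟨σ₂, σ₃, hσ₂, hσ₃, hβ⟩, hββ, h1, h2, h3⟩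
  rw [← real_inner_self_eq_norm_sq] at hββ
  have memW : ∀ i ∈ Finset.Icc 1 n, ∀ ε₁ ε₂ : ℝ, (ε₁ = 1 ∨ ε₁ = -1) → (ε₂ = 1 ∨ ε₂ = -1) →
      ε₁ • α i + ε₂ • β ∈ W := by
    intro i hi ε₁ ε₂ h h'
    rw [hW]
    exact ⟨i, hi, ε₁, ε₂, h, h', rfl⟩
  have normsq : ∀ (v : V) (s t : ℝ),
      ⟪s • v + t • β, s • v + t • β⟫ = s ^ 2 * ⟪v, v⟫ + 2 * s * t * ⟪β, v⟫ + t ^ 2 / 4 := by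
    intro v s t
    simp only [inner_add_left, inner_add_right, real_inner_smul_left, real_inner_smul_right,
      hββ, real_inner_comm β v]
    ring
  have lenW : ∀ i ∈ Finset.Icc 1 n, ∀ ε₁ ε₂ : ℝ, (ε₁ = 1 ∨ ε₁ = -1) → (ε₂ = 1 ∨ ε₂ = -1) →
      ε₁ ^ 2 * ⟪α i, α i⟫ + 2 * ε₁ * ε₂ * ⟪β, α i⟫ + ε₂ ^ 2 / 4 = 1 ∨
      ε₁ ^ 2 * ⟪α i, α i⟫ + 2 * ε₁ * ε₂ * ⟪β, α i⟫ + ε₂ ^ 2 / 4 = 2 := by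
    intro i hi ε₁ ε₂ h h'
    rw [← normsq]
    exact hlen _ (hWR (memW i hi ε₁ ε₂ h h'))
  have i1 : 1 ∈ Finset.Icc 1 n := by simp; omega
  have i2 : 2 ∈ Finset.Icc 1 n := by simp; omega
  have i3 : 3 ∈ Finset.Icc 1 n := by simp; omega
  have a11 : ⟪α 1, α 1⟫ = 5 / 4 := by
    have p := lenW 1 i1 1 1 (by simp) (by simp)
    have q := lenW 1 i1 1 (-1) (by simp) (by simp)
    rw [h1] at p q
    rcases p with p | p <;> rcases q with q | q <;> linarith
  have neg_mem : ∀ v : V, ∀ i ∈ Finset.Icc 1 n, ∀ ε₁ ε₂ : ℝ, (ε₁ = 1 ∨ ε₁ = -1) →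
      (ε₂ = 1 ∨ ε₂ = -1) → v = ε₁ • α i + ε₂ • β → v - (2 * ε₂) • β ∈ R := by
    intro v i hi ε₁ ε₂ h h' hv
    have := hWR (memW i hi ε₁ (-ε₂) h (by rcases h' with rfl | rfl <;> simp))
    convert this using 1
    rw [hv]
    module
  have two_not_mem : (2 : ℝ) • β ∉ R := by
    intro hmem
    have hS : (2 : ℝ) • β ∈ R \ W := by
      refine ⟨hmem, fun hw => ?_⟩
      rw [hW] at hw
      obtain ⟨i, hi, ε₁, ε₂, h, h', hv⟩ := hw
      have hR' := neg_mem _ i hi ε₁ ε₂ h h' hv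
      have hl := hlen _ hR'
      rw [show (2 : ℝ) • β - (2 * ε₂) • β = (0 : ℝ) • β + (2 - 2 * ε₂) • β by module,
        normsq] at hl
      rcases h' with rfl | rfl <;> norm_num at hl
    have hT : (1 : ℝ) • α 1 + (-3 : ℝ) • β ∈ R \ W := by
      constructor
      · have := hR.2.2.2.2 _ hmem _ (hWR (memW 1 i1 1 1 (by simp) (by simp)))
        convert this using 1
        simp only [inner_add_right, real_inner_smul_left, real_inner_smul_right, h1, hββ]
        module
      · intro hw
        rw [hW] at hw
        obtain ⟨i, hi, ε₁, ε₂, h, h', hv⟩ := hw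
        rcases h' with rfl | rfl
        · have hl := hlen _ (neg_mem _ i hi ε₁ 1 h (by simp) hv)
          rw [show (1 : ℝ) • α 1 + (-3 : ℝ) • β - (2 * 1 : ℝ) • β
            = (1 : ℝ) • α 1 + (-5 : ℝ) • β by module, normsq, a11, h1] at hl
          norm_num at hl
        · have := hdist 1 i1 i hi 1 (-1) ε₁ 1 (by simp) (by simp) h (by simp) (by
            rw [show ε₁ • α i + (1 : ℝ) • β = (ε₁ • α i + (-1 : ℝ) • β) + (2 : ℝ) • β by module,
              ← hv]
            module)
          norm_num at this
    have hw := memW 1 i1 1 (-1) (by simp) (by simp)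
    have hsum : (2 : ℝ) • β + ((1 : ℝ) • α 1 + (-3 : ℝ) • β)
        = (1 : ℝ) • α 1 + (-1 : ℝ) • β := by module
    have := hclosed _ hS _ hT (by rw [hsum]; exact hWR hw)
    rw [hsum] at this
    exact this.2 hw
  have orth : ∀ i ∈ Finset.Icc 1 n, ⟪β, α i⟫ = 0 → ⟪α i, α i⟫ = 7 / 4 := by
    intro i hi h0
    have p := lenW i hi 1 1 (by simp) (by simp)
    rw [h0] at p
    rcases p with p | p
    · have h34 : ⟪α i, α i⟫ = 3 / 4 := by linarith
      refine absurd ?_ two_not_mem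
      have := hR.sub_mem (hWR (memW i hi 1 (-1) (by simp) (by simp)))
        (hWR (memW i hi 1 1 (by simp) (by simp))) (by
          rw [normsq]
          simp only [inner_add_left, inner_add_right, real_inner_smul_left,
            real_inner_smul_right, hββ, real_inner_comm β (α i), h0, h34]
          norm_num)
      convert this using 1
      module
    · linarith
  have a22 := orth 2 i2 h2
  have a33 := orth 3 i3 h3
  have a23 : σ₂ * σ₃ * ⟪α 2, α 3⟫ = -5 / 4 := by
    have e : ⟪σ₂ • α 2 + σ₃ • α 3, σ₂ • α 2 + σ₃ • α 3⟫ = (1 : ℝ) := by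
      rw [show σ₂ • α 2 + σ₃ • α 3 = (-1 : ℝ) • α 1 + (1 : ℝ) • β by rw [hβ]; module,
        normsq, a11, h1]
      norm_num
    simp only [inner_add_left, inner_add_right, real_inner_smul_left, real_inner_smul_right,
      real_inner_comm (α 2) (α 3), a22, a33] at e
    have s2 : σ₂ * σ₂ = 1 := by rcases hσ₂ with rfl | rfl <;> norm_num
    have s3 : σ₃ * σ₃ = 1 := by rcases hσ₃ with rfl | rfl <;> norm_num
    linear_combination e / 2 - 7 / 8 * s2 - 7 / 8 * s3
  obtain ⟨k, hk⟩ := hR.2.2.2.1 _ (hWR (memW 2 i2 σ₂ 1 hσ₂ (by simp)))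
    _ (hWR (memW 3 i3 σ₃ (-1) hσ₃ (by simp)))
  have s2 : σ₂ ^ 2 = 1 := by rcases hσ₂ with rfl | rfl <;> norm_num
  rw [normsq, a22, h2, s2] at hk
  simp only [inner_add_left, inner_add_right, real_inner_smul_left, real_inner_smul_right,
    hββ, real_inner_comm β (α 2), h2, h3] at hk
  have hk' : (2 * k : ℝ) = -3 := by
    rw [← hk]
    linear_combination 2 * a23
  have : 2 * k = -3 := by exact_mod_cast hk'
  omega
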